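/- Every C*-weak Hopf algebra A possesses a Haar integral h (a two-sided integral with Π^L(h) = 1 = Π^R(h)), and h is selfadjoint: h* = h. Moreover, for every linear functional φ ∈ A* = Hom_ℂ(A, ℂ), the number Σ conj(φ(S(h₍₁₎)*)) · φ(h₍₂₎) is a nonnegative real number. -/

import Mathlib

open TensorProduct

noncomputable section

variable (K : Type*) [Field K] (A : Type*) [Ring A] [Algebra K A]

/-- `Π^L(x) = Σ ε(1₍₁₎ x) 1₍₂₎`. -/
def piL (Δ : A →ₗ[K] A ⊗[K] A) (ε : A →ₗ[K] K) : A →ₗ[K] A :=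
  (TensorProduct.lid K A).toLinearMap ∘ₗ ε.rTensor A ∘ₗ
    LinearMap.mulLeft K (Δ 1) ∘ₗ (TensorProduct.mk K A A).flip 1

/-- `Π^R(x) = Σ 1₍₁₎ ε(x 1₍₂₎)`. -/
def piR (Δ : A →ₗ[K] A ⊗[K] A) (ε : A →ₗ[K] K) : A →ₗ[K] A :=
  (TensorProduct.rid K A).toLinearMap ∘ₗ ε.lTensor A ∘ₗ
    LinearMap.mulRight K (Δ 1) ∘ₗ TensorProduct.mk K A A 1

/-- A weak bialgebra structure on the `K`-algebra `A`, with comultiplication `Δ`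
and counit `ε`. -/
structure WeakBialgebra (Δ : A →ₗ[K] A ⊗[K] A) (ε : A →ₗ[K] K) : Prop where
  coassoc : ∀ x : A,
    (TensorProduct.assoc K A A A) (Δ.rTensor A (Δ x)) = Δ.lTensor A (Δ x)
  counit_left : ∀ x : A, (TensorProduct.lid K A) (ε.rTensor A (Δ x)) = x
  counit_right : ∀ x : A, (TensorProduct.rid K A) (ε.lTensor A (Δ x)) = x
  comul_mul : ∀ x y : A, Δ (x * y) = Δ x * Δ y
  weak_counit_a : ∀ x y z : A,
    ε (x * y * z) =
      LinearMap.mul' K K (TensorProduct.map (ε ∘ₗ LinearMap.mulLeft K x)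
        (ε ∘ₗ LinearMap.mulRight K z) (Δ y))
  weak_counit_b : ∀ x y z : A,
    ε (x * y * z) =
      LinearMap.mul' K K (TensorProduct.map (ε ∘ₗ LinearMap.mulRight K z)
        (ε ∘ₗ LinearMap.mulLeft K x) (Δ y))
  weak_comul_unit_a :
    Δ.rTensor A (Δ 1) =
      (Δ 1 ⊗ₜ[K] (1 : A)) * ((TensorProduct.assoc K A A A).symm ((1 : A) ⊗ₜ[K] Δ 1))
  weak_comul_unit_b :
    Δ.rTensor A (Δ 1) =
      ((TensorProduct.assoc K A A A).symm ((1 : A) ⊗ₜ[K] Δ 1)) * (Δ 1 ⊗ₜ[K] (1 : A))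

/-- A weak Hopf algebra structure: a weak bialgebra together with an antipode `S`. -/
structure WeakHopfAlgebra (Δ : A →ₗ[K] A ⊗[K] A) (ε : A →ₗ[K] K) (S : A →ₗ[K] A) : Prop where
  toWeakBialgebra : WeakBialgebra K A Δ ε
  antipode_a : ∀ x : A,
    LinearMap.mul' K A (LinearMap.lTensor A S (Δ x)) = piL K A Δ ε x
  antipode_b : ∀ x : A,
    LinearMap.mul' K A (LinearMap.rTensor A S (Δ x)) = piR K A Δ ε x
  antipode_c : ∀ x : A,
    LinearMap.mul' K A (TensorProduct.map S (LinearMap.mul' K A ∘ₗ LinearMap.lTensor A S)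
      (LinearMap.lTensor A Δ (Δ x))) = S x

/-- For a `ℂ`-linear functional `f` on a `*`-algebra `A`, the functional
`a ↦ conj (f (star a))`; it is again `ℂ`-linear since `star` and complex conjugation
are both antilinear. -/
def conjDual (A : Type*) [Ring A] [Algebra ℂ A] [StarRing A] [StarModule ℂ A]
    (f : A →ₗ[ℂ] ℂ) : A →ₗ[ℂ] ℂ where
  toFun a := starRingEnd ℂ (f (star a))
  map_add' a b := by simp [star_add]
  map_smul' c a := by
    simp only [star_smul, map_smul, smul_eq_mul, starRingEnd_apply, star_mul', star_star,
      RingHom.id_apply]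

/-- A `C*`-weak Hopf algebra: a weak Hopf algebra over `ℂ` whose underlying algebra is a
finite-dimensional `C*`-algebra and whose comultiplication is a `*`-homomorphism, i.e.
`Δ(x*) = Σ (x₍₁₎)* ⊗ (x₍₂₎)*`.  The latter is expressed by pairing both sides with an
arbitrary pair of linear functionals `f ⊗ g`, which determines the element of `A ⊗ A`
uniquely: `Σ f((x₍₁₎)*) g((x₍₂₎)*) = conj (Σ (conjDual f)(x₍₁₎) (conjDual g)(x₍₂₎))`. -/
structure CStarWeakHopfAlgebra
    (A : Type*) [NormedRing A] [StarRing A] [CStarRing A] [NormedAlgebra ℂ A]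
    [StarModule ℂ A]
    (Δ : A →ₗ[ℂ] A ⊗[ℂ] A) (ε : A →ₗ[ℂ] ℂ) (S : A →ₗ[ℂ] A) : Prop where
  toWeakHopfAlgebra : WeakHopfAlgebra ℂ A Δ ε S
  comul_star : ∀ (f g : A →ₗ[ℂ] ℂ) (x : A),
    LinearMap.mul' ℂ ℂ (TensorProduct.map f g (Δ (star x))) =
      starRingEnd ℂ
        (LinearMap.mul' ℂ ℂ (TensorProduct.map (conjDual A f) (conjDual A g) (Δ x)))

section WeakBialgebra

variable {K A} {Δ : A →ₗ[K] A ⊗[K] A} {ε : A →ₗ[K] K} {S : A →ₗ[K] A}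

theorem piL_apply (x : A) :
    piL K A Δ ε x = TensorProduct.lid K A (ε.rTensor A (Δ 1 * (x ⊗ₜ[K] 1))) := rfl

theorem piR_apply (x : A) :
    piR K A Δ ε x = TensorProduct.rid K A (ε.lTensor A ((1 ⊗ₜ[K] x) * Δ 1)) := rfl

namespace WeakBialgebra

theorem comul_one_mul (hA : WeakBialgebra K A Δ ε) (x : A) : Δ 1 * Δ x = Δ x := by
  rw [← hA.comul_mul, one_mul]

theorem comul_mul_one (hA : WeakBialgebra K A Δ ε) (x : A) : Δ x * Δ 1 = Δ x := by
  rw [← hA.comul_mul, mul_one]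

theorem counit_mul_piL (hA : WeakBialgebra K A Δ ε) (x y : A) :
    ε (x * piL K A Δ ε y) = ε (x * y) := by
  have h := hA.weak_counit_b x 1 y
  rw [mul_one] at h
  rw [h, piL_apply]
  induction Δ 1 with
  | zero => simp
  | tmul a b => simp
  | add a b ha hb => simp only [add_mul, map_add, mul_add, ha, hb]

theorem counit_piR_mul (hA : WeakBialgebra K A Δ ε) (x y : A) :
    ε (piR K A Δ ε x * y) = ε (x * y) := by
  have h := hA.weak_counit_b x 1 y
  rw [mul_one] at h
  rw [h, piR_apply]
  induction Δ 1 with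
  | zero => simp
  | tmul a b => simp [mul_comm]
  | add a b ha hb => simp only [add_mul, map_add, mul_add, ha, hb]

theorem piL_eq_zero_iff (hA : WeakBialgebra K A Δ ε) {x : A} :
    piL K A Δ ε x = 0 ↔ ∀ y, ε (y * x) = 0 := by
  refine ⟨fun h y ↦ by rw [← hA.counit_mul_piL, h, mul_zero, map_zero], fun h ↦ ?_⟩
  rw [piL_apply]
  induction Δ 1 with
  | zero => simp
  | tmul a b => simp [h]
  | add a b ha hb => simp only [add_mul, map_add, ha, hb, add_zero]

theorem piR_eq_zero_iff (hA : WeakBialgebra K A Δ ε) {x : A} :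
    piR K A Δ ε x = 0 ↔ ∀ y, ε (x * y) = 0 := by
  refine ⟨fun h y ↦ by rw [← hA.counit_piR_mul, h, zero_mul, map_zero], fun h ↦ ?_⟩
  rw [piR_apply]
  induction Δ 1 with
  | zero => simp
  | tmul a b => simp [h]
  | add a b ha hb => simp only [mul_add, map_add, ha, hb, add_zero]

theorem piL_one (hA : WeakBialgebra K A Δ ε) : piL K A Δ ε 1 = 1 := by
  rw [piL_apply, ← Algebra.TensorProduct.one_def, mul_one, hA.counit_left]

theorem piR_one (hA : WeakBialgebra K A Δ ε) : piR K A Δ ε 1 = 1 := by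
  rw [piR_apply, ← Algebra.TensorProduct.one_def, one_mul, hA.counit_right]

/-- `Σ x₍₁₎ ⊗ Π^L(x₍₂₎) = Σ 1₍₁₎ x ⊗ 1₍₂₎`. -/
theorem lTensor_piL_comul (hA : WeakBialgebra K A Δ ε) (x : A) :
    (piL K A Δ ε).lTensor A (Δ x) = Δ 1 * (x ⊗ₜ[K] 1) := by
  let F : A ⊗[K] A ⊗[K] A →ₗ[K] A ⊗[K] A :=
    ((TensorProduct.rid K A).toLinearMap ∘ₗ ε.lTensor A).rTensor A
  have h₁ (X : A ⊗[K] A) : (piL K A Δ ε).lTensor A X =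
      F ((TensorProduct.assoc K A A A).symm ((1 : A) ⊗ₜ[K] Δ 1) * (X ⊗ₜ[K] 1)) := by
    induction X with
    | zero => simp
    | tmul a b =>
      rw [LinearMap.lTensor_tmul, piL_apply]
      induction Δ 1 with
      | zero => simp
      | tmul c d => simp [F, TensorProduct.smul_tmul]
      | add c d hc hd => simp only [add_mul, map_add, TensorProduct.tmul_add, hc, hd]
    | add a b ha hb => simp only [mul_add, map_add, TensorProduct.add_tmul, ha, hb]
  have h₂ (Y : A ⊗[K] A) : Δ.rTensor A Y * (Δ x ⊗ₜ[K] 1) = Δ.rTensor A (Y * (x ⊗ₜ[K] 1)) := by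
    induction Y with
    | zero => simp
    | tmul a b => simp [hA.comul_mul]
    | add a b ha hb => simp only [add_mul, map_add, ha, hb]
  have h₃ (Y : A ⊗[K] A) : F (Δ.rTensor A Y) = Y := by
    induction Y with
    | zero => simp
    | tmul a b => simp [F, hA.counit_right]
    | add a b ha hb => simp only [map_add, ha, hb]
  rw [h₁, ← hA.comul_one_mul x, ← one_mul (1 : A), ← Algebra.TensorProduct.tmul_mul_tmul,
    ← mul_assoc, one_mul, ← hA.weak_comul_unit_b, h₂, h₃]

/-- `Σ Π^R(x₍₁₎) ⊗ x₍₂₎ = Σ 1₍₁₎ ⊗ x 1₍₂₎`. -/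
theorem rTensor_piR_comul (hA : WeakBialgebra K A Δ ε) (x : A) :
    (piR K A Δ ε).rTensor A (Δ x) = (1 ⊗ₜ[K] x) * Δ 1 := by
  let F : A ⊗[K] A ⊗[K] A →ₗ[K] A ⊗[K] A :=
    ((TensorProduct.rid K A).toLinearMap ∘ₗ ε.lTensor A).rTensor A
  have h₁ (X : A ⊗[K] A) : (piR K A Δ ε).rTensor A X =
      F ((TensorProduct.assoc K A A A).symm ((1 : A) ⊗ₜ[K] X) * (Δ 1 ⊗ₜ[K] 1)) := by
    induction X with
    | zero => simp
    | tmul a b =>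
      rw [LinearMap.rTensor_tmul, piR_apply]
      induction Δ 1 with
      | zero => simp
      | tmul c d => simp [F]
      | add c d hc hd => simp only [mul_add, map_add, TensorProduct.add_tmul, hc, hd]
    | add a b ha hb => simp only [add_mul, map_add, TensorProduct.tmul_add, ha, hb]
  have h₂ (Y : A ⊗[K] A) : (TensorProduct.assoc K A A A).symm ((1 : A) ⊗ₜ[K] Δ x) *
      (TensorProduct.assoc K A A A).symm (Δ.lTensor A Y) =
      (TensorProduct.assoc K A A A).symm (Δ.lTensor A ((1 ⊗ₜ[K] x) * Y)) := by
    induction Y with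
    | zero => simp
    | tmul a b =>
      rw [Algebra.TensorProduct.tmul_mul_tmul, LinearMap.lTensor_tmul, LinearMap.lTensor_tmul,
        hA.comul_mul, one_mul]
      induction Δ x with
      | zero => simp
      | tmul c d =>
        induction Δ b with
        | zero => simp
        | tmul e f => simp
        | add e f he hf => simp only [mul_add, map_add, TensorProduct.tmul_add, he, hf]
      | add c d hc hd => simp only [add_mul, map_add, TensorProduct.tmul_add, hc, hd]
    | add a b ha hb => simp only [mul_add, map_add, ha, hb]
  have h₃ (Y : A ⊗[K] A) : F ((TensorProduct.assoc K A A A).symm (Δ.lTensor A Y)) = Y := by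
    induction Y with
    | zero => simp
    | tmul a b =>
      conv_rhs => rw [← hA.counit_left b]
      rw [LinearMap.lTensor_tmul]
      induction Δ b with
      | zero => simp
      | tmul c d => simp [F, TensorProduct.smul_tmul]
      | add c d hc hd => simp only [map_add, TensorProduct.tmul_add, hc, hd]
    | add a b ha hb => simp only [map_add, ha, hb]
  have h₄ : (TensorProduct.assoc K A A A).symm ((1 : A) ⊗ₜ[K] Δ x) =
      (TensorProduct.assoc K A A A).symm ((1 : A) ⊗ₜ[K] Δ x) *
        (TensorProduct.assoc K A A A).symm ((1 : A) ⊗ₜ[K] Δ 1) := by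
    conv_lhs => rw [← hA.comul_mul_one x]
    induction Δ x with
    | zero => simp
    | tmul c d =>
      induction Δ 1 with
      | zero => simp
      | tmul e f => simp
      | add e f he hf => simp only [mul_add, map_add, TensorProduct.tmul_add, he, hf]
    | add c d hc hd => simp only [add_mul, map_add, TensorProduct.tmul_add, hc, hd]
  rw [h₁, h₄, mul_assoc, ← hA.weak_comul_unit_b,
    ← (TensorProduct.assoc K A A A).symm_apply_apply (Δ.rTensor A (Δ 1)), hA.coassoc, h₂, h₃]

theorem comul_piL (hA : WeakBialgebra K A Δ ε) (x : A) :
    Δ (piL K A Δ ε x) = (piL K A Δ ε x ⊗ₜ[K] 1) * Δ 1 := by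
  let F : A ⊗[K] A ⊗[K] A →ₗ[K] A ⊗[K] A :=
    ((TensorProduct.lid K A).toLinearMap ∘ₗ ε.rTensor A).rTensor A
  have h₁ (Y : A ⊗[K] A) : Δ (TensorProduct.lid K A (ε.rTensor A (Y * (x ⊗ₜ[K] 1)))) =
      F ((TensorProduct.assoc K A A A).symm (Δ.lTensor A Y) * ((x ⊗ₜ[K] 1) ⊗ₜ[K] 1)) := by
    induction Y with
    | zero => simp
    | tmul a b =>
      simp only [Algebra.TensorProduct.tmul_mul_tmul, mul_one, LinearMap.rTensor_tmul,
        TensorProduct.lid_tmul, map_smul, LinearMap.lTensor_tmul]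
      induction Δ b with
      | zero => simp
      | tmul c d => simp [F, TensorProduct.smul_tmul']
      | add c d hc hd => simp only [add_mul, map_add, TensorProduct.tmul_add, smul_add, hc, hd]
    | add a b ha hb => simp only [add_mul, map_add, ha, hb]
  have h₂ (Y Z : A ⊗[K] A) :
      F ((Y ⊗ₜ[K] 1) * (TensorProduct.assoc K A A A).symm ((1 : A) ⊗ₜ[K] Z) *
        ((x ⊗ₜ[K] 1) ⊗ₜ[K] 1)) =
      (TensorProduct.lid K A (ε.rTensor A (Y * (x ⊗ₜ[K] 1))) ⊗ₜ[K] 1) * Z := by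
    induction Y with
    | zero => simp
    | tmul a b =>
      induction Z with
      | zero => simp
      | tmul c d => simp [F]
      | add c d hc hd => simp only [mul_add, add_mul, map_add, TensorProduct.tmul_add, hc, hd]
    | add a b ha hb => simp only [add_mul, map_add, TensorProduct.add_tmul, ha, hb]
  rw [piL_apply, h₁, ← h₂, ← hA.weak_comul_unit_a, ← hA.coassoc, LinearEquiv.symm_apply_apply]

theorem comul_piR (hA : WeakBialgebra K A Δ ε) (x : A) :
    Δ (piR K A Δ ε x) = Δ 1 * (1 ⊗ₜ[K] piR K A Δ ε x) := by
  let F : A ⊗[K] A ⊗[K] A →ₗ[K] A ⊗[K] A :=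
    (TensorProduct.rid K (A ⊗[K] A)).toLinearMap ∘ₗ ε.lTensor (A ⊗[K] A)
  have h₁ (Y : A ⊗[K] A) : Δ (TensorProduct.rid K A (ε.lTensor A ((1 ⊗ₜ[K] x) * Y))) =
      F ((1 ⊗ₜ[K] x) * Δ.rTensor A Y) := by
    induction Y with
    | zero => simp
    | tmul a b => simp [F]
    | add a b ha hb => simp only [mul_add, map_add, ha, hb]
  have h₂ (Y Z : A ⊗[K] A) :
      F ((1 ⊗ₜ[K] x) * ((Y ⊗ₜ[K] 1) * (TensorProduct.assoc K A A A).symm ((1 : A) ⊗ₜ[K] Z))) =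
      Y * (1 ⊗ₜ[K] TensorProduct.rid K A (ε.lTensor A ((1 ⊗ₜ[K] x) * Z))) := by
    induction Z with
    | zero => simp
    | tmul c d =>
      induction Y with
      | zero => simp
      | tmul a b => simp [F]
      | add a b ha hb => simp only [add_mul, mul_add, map_add, TensorProduct.add_tmul, ha, hb]
    | add c d hc hd => simp only [mul_add, map_add, TensorProduct.tmul_add, hc, hd]
  rw [piR_apply, h₁, ← h₂, ← hA.weak_comul_unit_a]

end WeakBialgebra

namespace WeakHopfAlgebra

theorem mul_antipode_piL (hA : WeakHopfAlgebra K A Δ ε S) (x : A) :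
    LinearMap.mul' K A (TensorProduct.map S (piL K A Δ ε) (Δ x)) = S x := by
  have h₁ : piL K A Δ ε = LinearMap.mul' K A ∘ₗ S.lTensor A ∘ₗ Δ := by
    ext y
    exact (hA.antipode_a y).symm
  have h₂ (Y : A ⊗[K] A) : TensorProduct.map S (piL K A Δ ε) Y =
      TensorProduct.map S (LinearMap.mul' K A ∘ₗ S.lTensor A) (Δ.lTensor A Y) := by
    rw [h₁, ← LinearMap.comp_apply, LinearMap.map_comp_lTensor]
    rfl
  rw [h₂, hA.antipode_c]

theorem mul_piR_antipode (hA : WeakHopfAlgebra K A Δ ε S) (x : A) :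
    LinearMap.mul' K A (TensorProduct.map (piR K A Δ ε) S (Δ x)) = S x := by
  have h₁ : piR K A Δ ε = LinearMap.mul' K A ∘ₗ S.rTensor A ∘ₗ Δ := by
    ext y
    exact (hA.antipode_b y).symm
  have h₂ (Y : A ⊗[K] A) : TensorProduct.map (piR K A Δ ε) S Y =
      TensorProduct.map (LinearMap.mul' K A ∘ₗ S.rTensor A) S (Δ.rTensor A Y) := by
    rw [h₁, ← LinearMap.comp_apply, LinearMap.map_comp_rTensor]
    rfl
  have h₃ (Z : A ⊗[K] A ⊗[K] A) :
      LinearMap.mul' K A (TensorProduct.map (LinearMap.mul' K A ∘ₗ S.rTensor A) S Z) =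
      LinearMap.mul' K A (TensorProduct.map S (LinearMap.mul' K A ∘ₗ S.lTensor A)
        (TensorProduct.assoc K A A A Z)) := by
    induction Z with
    | zero => simp
    | tmul Y c =>
      induction Y with
      | zero => simp
      | tmul a b => simp [mul_assoc]
      | add a b ha hb => simp only [TensorProduct.add_tmul, map_add, ha, hb]
    | add a b ha hb => simp only [map_add, ha, hb]
  rw [h₂, h₃, hA.toWeakBialgebra.coassoc, hA.antipode_c]

/-- `Σ h₍₁₎ ⊗ x h₍₂₎ = Σ S(x) h₍₁₎ ⊗ h₍₂₎` for a left integral `h`. -/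
theorem antipode_tmul_mul_comul (hA : WeakHopfAlgebra K A Δ ε S) {h : A}
    (hh : ∀ x, x * h = piL K A Δ ε x * h) (x : A) :
    (1 ⊗ₜ[K] x) * Δ h = (S x ⊗ₜ[K] 1) * Δ h := by
  have hB := hA.toWeakBialgebra
  let Ψ : A ⊗[K] (A ⊗[K] A) →ₗ[K] A ⊗[K] A := LinearMap.mulRight K (Δ h) ∘ₗ
    LinearMap.mul' K (A ⊗[K] A) ∘ₗ
      TensorProduct.map ((TensorProduct.mk K A A).flip 1 ∘ₗ S) LinearMap.id
  have h₁ (X : A ⊗[K] A) : Ψ (Δ.lTensor A X) =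
      (LinearMap.mul' K A (TensorProduct.map S (piL K A Δ ε) X) ⊗ₜ[K] 1) * Δ h := by
    induction X with
    | zero => simp
    | tmul a b =>
      simp only [Ψ, LinearMap.lTensor_tmul, LinearMap.comp_apply, TensorProduct.map_tmul,
        LinearMap.mul'_apply, LinearMap.mulRight_apply, LinearMap.flip_apply,
        TensorProduct.mk_apply, LinearMap.id_apply]
      rw [mul_assoc, ← hB.comul_mul, hh, hB.comul_mul, hB.comul_piL, mul_assoc, hB.comul_one_mul,
        ← mul_assoc, Algebra.TensorProduct.tmul_mul_tmul, mul_one]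
    | add a b ha hb => simp only [map_add, TensorProduct.add_tmul, add_mul, ha, hb]
  have h₂ (X : A ⊗[K] A) : Ψ (TensorProduct.assoc K A A A (Δ.rTensor A X)) =
      (piR K A Δ ε).rTensor A X * Δ h := by
    induction X with
    | zero => simp
    | tmul a b =>
      rw [LinearMap.rTensor_tmul, LinearMap.rTensor_tmul, ← hA.antipode_b]
      induction Δ a with
      | zero => simp
      | tmul c d => simp [Ψ]
      | add c d hc hd => simp only [map_add, TensorProduct.add_tmul, add_mul, hc, hd]
    | add a b ha hb => simp only [map_add, add_mul, ha, hb]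
  have h₃ := h₁ (Δ x)
  rw [← hB.coassoc, h₂, hB.rTensor_piR_comul, hA.mul_antipode_piL, mul_assoc,
    hB.comul_one_mul] at h₃
  exact h₃

/-- `Σ h₍₁₎ x ⊗ h₍₂₎ = Σ h₍₁₎ ⊗ h₍₂₎ S(x)` for a right integral `h`. -/
theorem comul_mul_tmul_antipode (hA : WeakHopfAlgebra K A Δ ε S) {h : A}
    (hh : ∀ x, h * x = h * piR K A Δ ε x) (x : A) :
    Δ h * (x ⊗ₜ[K] 1) = Δ h * (1 ⊗ₜ[K] S x) := by
  have hB := hA.toWeakBialgebra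
  let Ψ : A ⊗[K] A ⊗[K] A →ₗ[K] A ⊗[K] A := LinearMap.mulLeft K (Δ h) ∘ₗ
    LinearMap.mul' K (A ⊗[K] A) ∘ₗ
      TensorProduct.map LinearMap.id (TensorProduct.mk K A A 1 ∘ₗ S)
  have h₁ (X : A ⊗[K] A) : Ψ (Δ.rTensor A X) =
      Δ h * (1 ⊗ₜ[K] LinearMap.mul' K A (TensorProduct.map (piR K A Δ ε) S X)) := by
    induction X with
    | zero => simp
    | tmul a b =>
      simp only [Ψ, LinearMap.rTensor_tmul, LinearMap.comp_apply, TensorProduct.map_tmul,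
        LinearMap.mul'_apply, LinearMap.mulLeft_apply,
        TensorProduct.mk_apply, LinearMap.id_apply]
      rw [← mul_assoc, ← hB.comul_mul, hh, hB.comul_mul, hB.comul_piR, ← mul_assoc,
        hB.comul_mul_one, mul_assoc, Algebra.TensorProduct.tmul_mul_tmul, mul_one]
    | add a b ha hb => simp only [map_add, TensorProduct.tmul_add, mul_add, ha, hb]
  have h₂ (X : A ⊗[K] A) : Ψ ((TensorProduct.assoc K A A A).symm (Δ.lTensor A X)) =
      Δ h * (piL K A Δ ε).lTensor A X := by
    induction X with
    | zero => simp
    | tmul a b =>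
      rw [LinearMap.lTensor_tmul, LinearMap.lTensor_tmul, ← hA.antipode_a]
      induction Δ b with
      | zero => simp
      | tmul c d => simp [Ψ]
      | add c d hc hd => simp only [map_add, TensorProduct.tmul_add, mul_add, hc, hd]
    | add a b ha hb => simp only [map_add, mul_add, ha, hb]
  have h₃ := h₁ (Δ x)
  rw [← LinearEquiv.symm_apply_apply (TensorProduct.assoc K A A A) (Δ.rTensor A (Δ x)),
    hB.coassoc, h₂, hB.lTensor_piL_comul, hA.mul_piR_antipode, ← mul_assoc,
    hB.comul_mul_one] at h₃
  exact h₃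

theorem antipode_one (hA : WeakHopfAlgebra K A Δ ε S) {h : A}
    (hh : ∀ x, x * h = piL K A Δ ε x * h) (h1 : piL K A Δ ε h = 1) : S 1 = 1 := by
  have key (a : A) (X : A ⊗[K] A) : LinearMap.mul' K A (S.lTensor A ((a ⊗ₜ[K] 1) * X)) =
      a * LinearMap.mul' K A (S.lTensor A X) := by
    induction X with
    | zero => simp
    | tmul c d => simp [mul_assoc]
    | add c d hc hd => simp only [map_add, mul_add, hc, hd]
  have := congrArg (fun X ↦ LinearMap.mul' K A (S.lTensor A X))
    (hA.antipode_tmul_mul_comul hh 1)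
  simpa [key, hA.antipode_a, h1, ← Algebra.TensorProduct.one_def] using this.symm

theorem antipode_mul (hA : WeakHopfAlgebra K A Δ ε S) {h : A}
    (hh : ∀ x, x * h = piL K A Δ ε x * h) (h1 : piL K A Δ ε h = 1) (x y : A) :
    S (x * y) = S y * S x := by
  have key (a : A) (X : A ⊗[K] A) : LinearMap.mul' K A (S.lTensor A ((a ⊗ₜ[K] 1) * X)) =
      a * LinearMap.mul' K A (S.lTensor A X) := by
    induction X with
    | zero => simp
    | tmul c d => simp [mul_assoc]
    | add c d hc hd => simp only [map_add, mul_add, hc, hd]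
  have h₁ : (S (x * y) ⊗ₜ[K] 1) * Δ h = ((S y * S x) ⊗ₜ[K] 1) * Δ h := by
    calc (S (x * y) ⊗ₜ[K] 1) * Δ h = (1 ⊗ₜ[K] x) * ((1 ⊗ₜ[K] y) * Δ h) := by
          rw [← hA.antipode_tmul_mul_comul hh, ← mul_assoc, Algebra.TensorProduct.tmul_mul_tmul,
            one_mul]
      _ = (S y ⊗ₜ[K] 1) * ((1 ⊗ₜ[K] x) * Δ h) := by
          rw [hA.antipode_tmul_mul_comul hh y, ← mul_assoc, ← mul_assoc]
          simp
      _ = _ := by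
          rw [hA.antipode_tmul_mul_comul hh x, ← mul_assoc]
          simp
  have := congrArg (fun X ↦ LinearMap.mul' K A (S.lTensor A X)) h₁
  simpa [key, hA.antipode_a, h1] using this

end WeakHopfAlgebra

end WeakBialgebra
theorem tensor_ext_functional {A : Type*} [Ring A] [Algebra ℂ A]
    [FiniteDimensional ℂ A] {X Y : A ⊗[ℂ] A}
    (h : ∀ f g : A →ₗ[ℂ] ℂ, LinearMap.mul' ℂ ℂ (TensorProduct.map f g X) =
      LinearMap.mul' ℂ ℂ (TensorProduct.map f g Y)) : X = Y := by
  let b := Module.finBasis ℂ A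
  refine (b.tensorProduct b).ext_elem fun ⟨i, j⟩ ↦ ?_
  have key (Z : A ⊗[ℂ] A) : (b.tensorProduct b).repr Z (i, j) =
      LinearMap.mul' ℂ ℂ (TensorProduct.map (b.coord i) (b.coord j) Z) := by
    induction Z with
    | zero => simp
    | tmul c d => simp [mul_comm]
    | add c d hc hd => simp only [map_add, Finsupp.add_apply, hc, hd]
  rw [key, key, h]

section Star

open ComplexConjugate

section Algebra

variable {A : Type*} [Ring A] [StarRing A] [Algebra ℂ A] [StarModule ℂ A]

theorem star_mul_tensor (X Y : A ⊗[ℂ] A) : star (X * Y) = star Y * star X := by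
  induction X with
  | zero => simp
  | tmul a b =>
    induction Y with
    | zero => simp
    | tmul c d => simp
    | add c d hc hd => simp only [mul_add, add_mul, star_add, hc, hd]
  | add a b ha hb => simp only [mul_add, add_mul, star_add, ha, hb]

theorem conjDual_apply (f : A →ₗ[ℂ] ℂ) (a : A) : conjDual A f a = conj (f (star a)) := rfl

theorem conjDual_conjDual (f : A →ₗ[ℂ] ℂ) : conjDual A (conjDual A f) = f := by
  ext a
  simp [conjDual_apply]

theorem mul'_map_star (f g : A →ₗ[ℂ] ℂ) (X : A ⊗[ℂ] A) :
    LinearMap.mul' ℂ ℂ (TensorProduct.map f g (star X)) =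
      conj (LinearMap.mul' ℂ ℂ (TensorProduct.map (conjDual A f) (conjDual A g) X)) := by
  induction X with
  | zero => simp
  | tmul a b => simp [conjDual_apply]
  | add a b ha hb => simp only [star_add, map_add, ha, hb]

end Algebra

namespace CStarWeakHopfAlgebra

variable {A : Type*} [NormedRing A] [StarRing A] [CStarRing A] [NormedAlgebra ℂ A]
  [StarModule ℂ A] {Δ : A →ₗ[ℂ] A ⊗[ℂ] A} {ε : A →ₗ[ℂ] ℂ} {S : A →ₗ[ℂ] A}

theorem comul_star_eq [FiniteDimensional ℂ A] (hA : CStarWeakHopfAlgebra A Δ ε S) (x : A) :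
    Δ (star x) = star (Δ x) :=
  tensor_ext_functional fun f g ↦ by rw [hA.comul_star, mul'_map_star]

theorem counit_star (hA : CStarWeakHopfAlgebra A Δ ε S) (x : A) : ε (star x) = conj (ε x) := by
  have hB := hA.toWeakHopfAlgebra.toWeakBialgebra
  have h₁ (g : A →ₗ[ℂ] ℂ) (y : A) : LinearMap.mul' ℂ ℂ (TensorProduct.map ε g (Δ y)) = g y := by
    conv_rhs => rw [← hB.counit_left y]
    induction Δ y with
    | zero => simp
    | tmul a b => simp
    | add a b ha hb => simp only [map_add, ha, hb]
  have h₂ (g : A →ₗ[ℂ] ℂ) (y : A) : LinearMap.mul' ℂ ℂ (TensorProduct.map g ε (Δ y)) = g y := by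
    conv_rhs => rw [← hB.counit_right y]
    induction Δ y with
    | zero => simp
    | tmul a b => simp [mul_comm]
    | add a b ha hb => simp only [map_add, ha, hb]
  have h₃ := hA.comul_star (conjDual A ε) ε x
  rw [h₂, conjDual_conjDual, h₁, conjDual_apply] at h₃
  simpa [conjDual_apply] using h₃.symm

theorem piR_star_eq_zero_iff (hA : CStarWeakHopfAlgebra A Δ ε S) {x : A} :
    piR ℂ A Δ ε (star x) = 0 ↔ piL ℂ A Δ ε x = 0 := by
  have hB := hA.toWeakHopfAlgebra.toWeakBialgebra
  rw [hB.piL_eq_zero_iff, hB.piR_eq_zero_iff]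
  refine ⟨fun h y ↦ ?_, fun h y ↦ ?_⟩
  · simpa [← hA.counit_star] using congrArg conj (h (star y))
  · simpa [← hA.counit_star] using congrArg conj (h (star y))

/-- In the presence of a selfadjoint two-sided normalized integral, `x ↦ S(x*)*` is inverse
to `S`. -/
theorem antipode_star_antipode_star [FiniteDimensional ℂ A] (hA : CStarWeakHopfAlgebra A Δ ε S)
    {h : A} (hl : ∀ x, x * h = piL ℂ A Δ ε x * h) (hr : ∀ x, h * x = h * piR ℂ A Δ ε x)
    (h1 : piR ℂ A Δ ε h = 1) (hs : star h = h) (x : A) : S (star (S (star x))) = x := by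
  have hW := hA.toWeakHopfAlgebra
  have key (a : A) (X : A ⊗[ℂ] A) : LinearMap.mul' ℂ A (S.rTensor A (X * (1 ⊗ₜ[ℂ] a))) =
      LinearMap.mul' ℂ A (S.rTensor A X) * a := by
    induction X with
    | zero => simp
    | tmul c d => simp [mul_assoc]
    | add c d hc hd => simp only [map_add, add_mul, hc, hd]
  have h₁ : Δ h * (1 ⊗ₜ[ℂ] x) = Δ h * (star (S (star x)) ⊗ₜ[ℂ] 1) := by
    have := congrArg star (hW.antipode_tmul_mul_comul hl (star x))
    simpa only [star_mul_tensor, ← hA.comul_star_eq, hs, TensorProduct.star_tmul, star_one,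
      star_star] using this
  rw [hW.comul_mul_tmul_antipode hr] at h₁
  have h₂ := congrArg (fun X ↦ LinearMap.mul' ℂ A (S.rTensor A X)) h₁
  simpa [key, hW.antipode_b, h1] using h₂.symm

end CStarWeakHopfAlgebra

end Star

section Trace

open ComplexConjugate

open scoped ComplexOrder

/-- A faithful positive tracial functional on a complex `*`-algebra. -/
structure IsFaithfulTrace {A : Type*} [Ring A] [StarRing A] [Algebra ℂ A]
    (t : A →ₗ[ℂ] ℂ) : Prop where
  mul_comm : ∀ a b, t (a * b) = t (b * a)
  map_star : ∀ a, t (star a) = conj (t a)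
  re_nonneg : ∀ a, 0 ≤ (t (star a * a)).re
  definite : ∀ a, t (star a * a) = 0 → a = 0

/-- A finite-dimensional C*-algebra carries a faithful positive trace. -/
theorem exists_faithful_trace (A : Type*) [CStarAlgebra A] [FiniteDimensional ℂ A] :
    ∃ t : A →ₗ[ℂ] ℂ, IsFaithfulTrace t := by
  let _ := CStarAlgebra.spectralOrder A
  have _ := CStarAlgebra.spectralOrderedRing A
  let τ : A →ₗ[ℂ] ℂ := LinearMap.trace ℂ A ∘ₗ (Algebra.lmul ℂ A).toLinearMap
  have hroots (a x : A) (hx : x = star a * a) (μ : ℂ)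
      (hμ : μ ∈ (Algebra.lmul ℂ A x).charpoly.roots) : μ ∈ spectrum ℂ x ∧ 0 ≤ μ := by
    have h := AlgHom.spectrum_apply_subset (Algebra.lmul ℂ A) x
      ((Module.End.mem_spectrum_iff_isRoot_charpoly _ μ).2 (Polynomial.isRoot_of_mem_roots hμ))
    exact ⟨h, spectrum_nonneg_of_nonneg (hx ▸ star_mul_self_nonneg a) h⟩
  have hsum (x : A) : τ x = (Algebra.lmul ℂ A x).charpoly.roots.sum := by
    let b := Module.finBasis ℂ A
    rw [← LinearMap.charpoly_toMatrix _ b, ← Matrix.trace_eq_sum_roots_charpoly]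
    exact LinearMap.trace_eq_matrix_trace ℂ b _
  have hnonneg (a : A) : 0 ≤ τ (star a * a) := by
    rw [hsum]
    exact Multiset.sum_nonneg fun μ hμ ↦ (hroots a _ rfl μ hμ).2
  have hdef (a : A) (h : τ (star a * a) = 0) : a = 0 := by
    rw [hsum] at h
    have hzero (μ : ℂ) (hμ : μ ∈ (Algebra.lmul ℂ A (star a * a)).charpoly.roots) : μ = 0 := by
      refine (hroots a _ rfl μ hμ).2.antisymm' ?_
      rw [← h]
      exact Multiset.single_le_sum (fun ν hν ↦ (hroots a _ rfl ν hν).2) μ hμ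
    have hspec : spectrum ℂ (star a * a) ⊆ {0} := by
      intro μ hμ
      replace hμ : μ ∈ spectrum ℂ (Algebra.lmul ℂ A (star a * a)) := by
        rwa [spectrum.mem_iff, ← AlgHom.commutes (Algebra.lmul ℂ A), ← map_sub,
          Algebra.lmul_isUnit_iff]
      refine hzero μ ((Polynomial.mem_roots (LinearMap.charpoly_monic _).ne_zero).2 ?_)
      exact (Module.End.mem_spectrum_iff_isRoot_charpoly _ μ).1 hμ
    exact CStarRing.star_mul_self_eq_zero_iff a |>.1
      (CFC.eq_zero_of_spectrum_subset_zero (R := ℂ) (p := IsStarNormal) _ hspec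
        (IsSelfAdjoint.star_mul_self a).isStarNormal)
  let τ' : A →ₗ[ℂ] ℂ := τ + conjDual A τ
  have hτ' (a : A) : τ' (star a * a) = 2 * τ (star a * a) := by
    have : conj (τ (star a * a)) = τ (star a * a) :=
      Complex.conj_eq_iff_im.2 (Complex.le_def.1 (hnonneg a)).2.symm
    simp [τ', conjDual_apply, this, two_mul]
  have hcomm (a b : A) : τ (a * b) = τ (b * a) := by
    simp only [τ, LinearMap.comp_apply, AlgHom.toLinearMap_apply, map_mul]
    exact LinearMap.trace_mul_comm ℂ _ _
  refine ⟨τ', ⟨fun a b ↦ ?_, fun a ↦ ?_, fun a ↦ ?_, fun a h ↦ ?_⟩⟩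
  · simp [τ', conjDual_apply, hcomm a b, hcomm (star b) (star a)]
  · simp [τ', conjDual_apply, add_comm]
  · rw [hτ']
    simpa using (Complex.le_def.1 (hnonneg a)).1
  · rw [hτ'] at h
    exact hdef a (by simpa using h)

end Trace

section Haar

open ComplexConjugate

open scoped ComplexOrder

theorem InnerProductSpace.Core.exists_sum_inner_smul_eq {V : Type*} [AddCommGroup V] [Module ℂ V]
    [FiniteDimensional ℂ V] (c : InnerProductSpace.Core ℂ V) :
    ∃ (n : ℕ) (a : Fin n → V), ∀ x, ∑ i, c.inner (a i) x • a i = x := by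
  let _ : NormedAddCommGroup V := c.toNormedAddCommGroup
  let _ : InnerProductSpace ℂ V := InnerProductSpace.ofCore c.toCore
  exact ⟨_, stdOrthonormalBasis ℂ V, (stdOrthonormalBasis ℂ V).sum_repr'⟩

theorem InnerProductSpace.Core.exists_mem_inner_sub_eq_zero {V : Type*} [AddCommGroup V]
    [Module ℂ V] [FiniteDimensional ℂ V] (c : InnerProductSpace.Core ℂ V) (L : Submodule ℂ V)
    (x : V) : ∃ u ∈ L, ∀ w ∈ L, c.inner w (x - u) = 0 := by
  let _ : NormedAddCommGroup V := c.toNormedAddCommGroup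
  let _ : InnerProductSpace ℂ V := InnerProductSpace.ofCore c.toCore
  have := FiniteDimensional.complete ℂ L
  refine ⟨L.starProjection x, L.starProjection_apply_mem x, fun w hw ↦ ?_⟩
  exact (Submodule.mem_orthogonal L _).1 (L.sub_starProjection_mem_orthogonal x) w hw

namespace IsFaithfulTrace

section Algebra

variable {A : Type*} [Ring A] [StarRing A] [Algebra ℂ A] {t : A →ₗ[ℂ] ℂ}

theorem nonneg (ht : IsFaithfulTrace t) (a : A) : 0 ≤ t (star a * a) := by
  refine Complex.le_def.2 ⟨ht.re_nonneg a, ?_⟩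
  exact (Complex.conj_eq_iff_im.1 (by rw [← ht.map_star]; simp)).symm

variable [StarModule ℂ A]

/-- The inner product `⟪a, b⟫ = t (a* b)`. -/
@[reducible]
def core (ht : IsFaithfulTrace t) : InnerProductSpace.Core ℂ A where
  inner a b := t (star a * b)
  conj_inner_symm a b := by simp [← ht.map_star]
  re_inner_nonneg := ht.re_nonneg
  add_left a b c := by simp [add_mul]
  smul_left a b r := by simp
  definite := ht.definite

theorem core_inner (ht : IsFaithfulTrace t) (a b : A) : ht.core.inner a b = t (star a * b) := rfl

variable {n : ℕ} {a : Fin n → A}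

theorem sum_smul_star (ht : IsFaithfulTrace t) (ha : ∀ x, ∑ i, t (star (a i) * x) • a i = x)
    (x : A) : ∑ i, t (x * a i) • star (a i) = x := by
  have := congrArg star (ha (star x))
  simpa [star_sum, ← starRingEnd_apply, ← ht.map_star] using this

theorem sum_star_tmul_mul (ht : IsFaithfulTrace t)
    (ha : ∀ x, ∑ i, t (star (a i) * x) • a i = x) (x : A) :
    ∑ i, star (a i) ⊗ₜ[ℂ] (x * a i) = ∑ i, (star (a i) * x) ⊗ₜ[ℂ] a i := by
  calc ∑ i, star (a i) ⊗ₜ[ℂ] (x * a i)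
      = ∑ i, ∑ j, t (star (a j) * x * a i) • star (a i) ⊗ₜ[ℂ] a j := by
        refine Finset.sum_congr rfl fun i _ ↦ ?_
        conv_lhs => rw [← ha (x * a i)]
        simp [TensorProduct.tmul_sum, TensorProduct.tmul_smul, mul_assoc]
    _ = _ := by
        rw [Finset.sum_comm]
        refine Finset.sum_congr rfl fun j _ ↦ ?_
        conv_rhs => rw [← ht.sum_smul_star ha (star (a j) * x)]
        simp [TensorProduct.sum_tmul, TensorProduct.smul_tmul']

theorem sum_star_tmul_mul' (ht : IsFaithfulTrace t)
    (ha : ∀ x, ∑ i, t (star (a i) * x) • a i = x) (x : A) :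
    ∑ i, star (a i) ⊗ₜ[ℂ] (a i * x) = ∑ i, (x * star (a i)) ⊗ₜ[ℂ] a i := by
  calc ∑ i, star (a i) ⊗ₜ[ℂ] (a i * x)
      = ∑ i, ∑ j, t (x * star (a j) * a i) • star (a i) ⊗ₜ[ℂ] a j := by
        refine Finset.sum_congr rfl fun i _ ↦ ?_
        conv_lhs => rw [← ha (a i * x)]
        simp only [TensorProduct.tmul_sum, TensorProduct.tmul_smul]
        refine Finset.sum_congr rfl fun j _ ↦ ?_
        rw [← mul_assoc, ht.mul_comm, ← mul_assoc]
    _ = _ := by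
        rw [Finset.sum_comm]
        refine Finset.sum_congr rfl fun j _ ↦ ?_
        conv_rhs => rw [← ht.sum_smul_star ha (x * star (a j))]
        simp [TensorProduct.sum_tmul, TensorProduct.smul_tmul']

end Algebra

section CStar

variable {A : Type*} [CStarAlgebra A] {t : A →ₗ[ℂ] ℂ} {n : ℕ} {a : Fin n → A}

theorem isUnit_sum_mul_star [FiniteDimensional ℂ A] (ht : IsFaithfulTrace t) {b : Fin n → A}
    (hb : (1 : A) ∈ Submodule.span ℂ (Set.range b)) : IsUnit (∑ i, b i * star (b i)) := by
  rw [← Algebra.lmul_isUnit_iff (R := ℂ), LinearMap.isUnit_iff_ker_eq_bot, LinearMap.ker_eq_bot']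
  intro x hx
  replace hx : ∑ i, b i * star (b i) * x = 0 := by simpa [Finset.sum_mul] using hx
  have h₁ : ∑ i, t (star (star (b i) * x) * (star (b i) * x)) = 0 := by
    have := congrArg (fun z ↦ t (star x * z)) hx
    simpa [Finset.mul_sum, mul_assoc] using this
  have h₂ (i : Fin n) : star (b i) * x = 0 :=
    ht.definite _ ((Finset.sum_eq_zero_iff_of_nonneg fun i _ ↦ ht.nonneg _).1 h₁ i
      (Finset.mem_univ i))
  have h₃ (z : A) (hz : z ∈ Submodule.span ℂ (Set.range b)) : star z * x = 0 := by
    induction hz using Submodule.span_induction with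
    | mem z hz =>
      obtain ⟨i, rfl⟩ := hz
      exact h₂ i
    | zero => simp
    | add z w _ _ hz hw => simp [add_mul, hz, hw]
    | smul c z _ hz => simp [hz]
  simpa using h₃ 1 hb

/-- An invertible antimultiplicative map `S` with `S(S(x)*)* = x` satisfies `S²(x) = G x G⁻¹`
for `G = ∑ S(aᵢ) S(aᵢ)*`. -/
theorem antipode_sq_mul (ht : IsFaithfulTrace t)
    (ha : ∀ x, ∑ i, t (star (a i) * x) • a i = x) {S : A →ₗ[ℂ] A}
    (hmul : ∀ x y, S (x * y) = S y * S x) (hS : ∀ x, star (S (star (S x))) = x) (x : A) :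
    S (S x) * ∑ i, S (a i) * star (S (a i)) = (∑ i, S (a i) * star (S (a i))) * x := by
  let R : A →ₗ[ℂ] A :=
    { toFun b := star (S (star b))
      map_add' b c := by simp
      map_smul' r b := by simp }
  have h := congrArg (LinearMap.mul' ℂ A ∘ₗ TensorProduct.map S R ∘ₗ
    (TensorProduct.comm ℂ A A).toLinearMap) (ht.sum_star_tmul_mul' ha (S x))
  simp only [map_sum, LinearMap.comp_apply, LinearEquiv.coe_coe, TensorProduct.comm_tmul,
    TensorProduct.map_tmul, LinearMap.mul'_apply, hmul, mul_assoc, R, LinearMap.coe_mk,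
    AddHom.coe_mk, star_mul, star_star, hS] at h
  simpa [Finset.mul_sum, Finset.sum_mul, mul_assoc] using h

theorem exists_eq_sum_star_tmul [FiniteDimensional ℂ A] (ht : IsFaithfulTrace t)
    {S : A →ₗ[ℂ] A} (hone : S 1 = 1) (hmul : ∀ x y, S (x * y) = S y * S x)
    (hS : ∀ x, star (S (star (S x))) = x) {T : A ⊗[ℂ] A}
    (hT₁ : ∀ x, (x ⊗ₜ[ℂ] 1) * T = T * (1 ⊗ₜ[ℂ] x))
    (hT₂ : ∀ x, (1 ⊗ₜ[ℂ] x) * T = T * (S (S x) ⊗ₜ[ℂ] 1)) (hT : LinearMap.mul' ℂ A T = 1) :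
    ∃ (n : ℕ) (b : Fin n → A), T = ∑ i, star (b i) ⊗ₜ[ℂ] b i := by
  let _ := CStarAlgebra.spectralOrder A
  have _ := CStarAlgebra.spectralOrderedRing A
  obtain ⟨n, a, ha⟩ := ht.core.exists_sum_inner_smul_eq
  simp only [core_inner] at ha
  let F : A ⊗[ℂ] A →ₗ[ℂ] A := (TensorProduct.lid ℂ A).toLinearMap ∘ₗ t.rTensor A
  have hF_tmul (x y : A) : F (x ⊗ₜ[ℂ] y) = t x • y := rfl
  have hF₁ (x : A) (X : A ⊗[ℂ] A) : F (X * (1 ⊗ₜ[ℂ] x)) = F X * x := by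
    induction X with
    | zero => simp
    | tmul p q => simp [hF_tmul]
    | add p q hp hq => simp only [map_add, add_mul, hp, hq]
  have hF₂ (x : A) (X : A ⊗[ℂ] A) : F ((1 ⊗ₜ[ℂ] x) * X) = x * F X := by
    induction X with
    | zero => simp
    | tmul p q => simp [hF_tmul]
    | add p q hp hq => simp only [map_add, mul_add, hp, hq]
  have hF₃ (x : A) (X : A ⊗[ℂ] A) : F (X * (x ⊗ₜ[ℂ] 1)) = F ((x ⊗ₜ[ℂ] 1) * X) := by
    induction X with
    | zero => simp
    | tmul p q => simp [hF_tmul, ht.mul_comm]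
    | add p q hp hq => simp only [map_add, add_mul, mul_add, hp, hq]
  have hexp (X : A ⊗[ℂ] A) : ∑ j, star (a j) ⊗ₜ[ℂ] F ((a j ⊗ₜ[ℂ] 1) * X) = X := by
    induction X with
    | zero => simp
    | tmul p q =>
      conv_rhs => rw [← ht.sum_smul_star ha p]
      simp [hF_tmul, TensorProduct.sum_tmul, TensorProduct.smul_tmul', TensorProduct.tmul_smul,
        ht.mul_comm]
    | add p q hp hq =>
      simp only [map_add, mul_add, TensorProduct.tmul_add, Finset.sum_add_distrib, hp, hq]
  let y := F T
  have hTy : T = ∑ j, star (a j) ⊗ₜ[ℂ] (y * a j) := by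
    conv_lhs => rw [← hexp T]
    simp [hT₁, hF₁, y]
  have hy (x : A) : x * y = y * S (S x) := by
    rw [← hF₂, hT₂, hF₃, hT₁, hF₁]
  let G := ∑ i, S (a i) * star (S (a i))
  have hGnonneg : 0 ≤ G := Finset.sum_nonneg fun i _ ↦ mul_star_self_nonneg _
  have hGunit : IsUnit G := by
    refine ht.isUnit_sum_mul_star (b := fun i ↦ S (a i)) ?_
    rw [← hone, ← ha 1, map_sum]
    refine Submodule.sum_mem _ fun i _ ↦ ?_
    rw [map_smul]
    exact Submodule.smul_mem _ _ (Submodule.subset_span ⟨i, rfl⟩)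
  obtain ⟨g, hGg, hgG⟩ := isUnit_iff_exists.1 hGunit
  have hg : 0 ≤ g := by
    have hs : star g = g := by
      have := congrArg star hgG
      rw [star_mul, star_one, (IsSelfAdjoint.of_nonneg hGnonneg).star_eq] at this
      exact (left_inv_eq_right_inv hgG this).symm
    have := star_right_conjugate_nonneg hGnonneg g
    rwa [hgG, one_mul, hs] at this
  let c := y * G
  have hc (x : A) : x * c = c * x := by
    simp only [c]
    rw [← mul_assoc, hy, mul_assoc, ht.antipode_sq_mul ha hmul hS, mul_assoc]
  have hyc : y = c * g := by simp [c, mul_assoc, hGg]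
  have hcnonneg : 0 ≤ c := by
    have hN : 0 ≤ ∑ i, star (a i) * g * a i :=
      Finset.sum_nonneg fun i _ ↦ star_left_conjugate_nonneg hg _
    have hcN : c * ∑ i, star (a i) * g * a i = 1 := by
      rw [← hT, hTy, map_sum, Finset.mul_sum]
      refine Finset.sum_congr rfl fun i _ ↦ ?_
      rw [LinearMap.mul'_apply, hyc, ← mul_assoc, ← mul_assoc, ← mul_assoc, ← mul_assoc, hc]
    have h := star_right_conjugate_nonneg hN c
    rw [hcN, one_mul] at h
    rwa [← (IsSelfAdjoint.of_nonneg h).star_eq, star_star] at h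
  have hynonneg : 0 ≤ y := hyc ▸ Commute.mul_nonneg hcnonneg hg (hc g).symm
  obtain ⟨k, hk⟩ := CStarAlgebra.nonneg_iff_eq_star_mul_self.1 hynonneg
  refine ⟨n, fun i ↦ star k * a i, ?_⟩
  have h := congrArg (fun X ↦ (1 ⊗ₜ[ℂ] star k) * X) (ht.sum_star_tmul_mul ha k)
  simpa [hTy, hk, Finset.mul_sum, mul_assoc] using h

end CStar

end IsFaithfulTrace

namespace CStarWeakHopfAlgebra

variable {A : Type*} [CStarAlgebra A] [FiniteDimensional ℂ A]
  {Δ : A →ₗ[ℂ] A ⊗[ℂ] A} {ε : A →ₗ[ℂ] ℂ} {S : A →ₗ[ℂ] A}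

/-- The Haar integral is the component of `1` orthogonal to `ker Π^L`. -/
theorem exists_haar_integral (hA : CStarWeakHopfAlgebra A Δ ε S) {t : A →ₗ[ℂ] ℂ}
    (ht : IsFaithfulTrace t) :
    ∃ h : A, (∀ x, x * h = piL ℂ A Δ ε x * h) ∧ (∀ x, h * x = h * piR ℂ A Δ ε x) ∧
      piL ℂ A Δ ε h = 1 ∧ piR ℂ A Δ ε h = 1 ∧ star h = h := by
  have hB := hA.toWeakHopfAlgebra.toWeakBialgebra
  let L := LinearMap.ker (piL ℂ A Δ ε)
  have hmem {x : A} : x ∈ L ↔ piL ℂ A Δ ε x = 0 := LinearMap.mem_ker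
  have hideal (x : A) {u : A} (hu : u ∈ L) : x * u ∈ L := by
    rw [hmem, hB.piL_eq_zero_iff] at hu ⊢
    exact fun y ↦ by rw [← mul_assoc, hu]
  obtain ⟨u, hu, horth⟩ := ht.core.exists_mem_inner_sub_eq_zero L 1
  simp only [ht.core_inner] at horth
  set h := 1 - u with hh
  have hann {x : A} (hx : x ∈ L) : x * h = 0 := by
    refine ht.definite _ ?_
    have hw : star x * (x * h) ∈ L := by
      refine hideal _ ?_
      rw [hh, mul_sub, mul_one]
      exact L.sub_mem hx (hideal x hu)
    simpa [mul_assoc] using horth _ hw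
  have huh : u * star h = 0 := by
    refine ht.definite _ ?_
    have := horth _ (hideal (h * star u) hu)
    rw [ht.mul_comm] at this
    simpa [mul_assoc] using this
  have hs : star h = h := by
    have h₁ : star h = h * star h := by
      conv_lhs => rw [← one_mul (star h), ← sub_add_cancel 1 u, add_mul, huh, add_zero, ← hh]
    exact h₁.trans (by simpa using (congrArg star h₁).symm)
  have hus : star u = u := by
    have : star (1 - u) = 1 - u := hs
    simpa using this
  have hl (x : A) : x * h = piL ℂ A Δ ε x * h := by
    rw [← sub_eq_zero, ← sub_mul]
    refine hann (hmem.2 (hB.piL_eq_zero_iff.2 fun y ↦ ?_))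
    rw [mul_sub, map_sub, hB.counit_mul_piL, sub_self]
  have hr (x : A) : h * x = h * piR ℂ A Δ ε x := by
    have h₁ : star (x - piR ℂ A Δ ε x) ∈ L := by
      rw [hmem, ← hA.piR_star_eq_zero_iff, star_star, hB.piR_eq_zero_iff]
      intro y
      rw [sub_mul, map_sub, hB.counit_piR_mul, sub_self]
    have h₂ := congrArg star (hann h₁)
    rwa [star_mul, star_star, hs, star_zero, mul_sub, sub_eq_zero] at h₂
  refine ⟨h, hl, hr, ?_, ?_, hs⟩
  · rw [hh, map_sub, hB.piL_one, hmem.1 hu, sub_zero]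
  · rw [hh, map_sub, hB.piR_one, ← hus, hA.piR_star_eq_zero_iff.2 (hmem.1 hu), sub_zero]

/-- The positivity of the Haar integral with respect to the form `Σ conj(φ(S(h₍₁₎)*)) φ(h₍₂₎)`. -/
theorem exists_nonneg_mul'_map (hA : CStarWeakHopfAlgebra A Δ ε S) {t : A →ₗ[ℂ] ℂ}
    (ht : IsFaithfulTrace t) {h : A} (hl : ∀ x, x * h = piL ℂ A Δ ε x * h)
    (hr : ∀ x, h * x = h * piR ℂ A Δ ε x) (hl₁ : piL ℂ A Δ ε h = 1) (hr₁ : piR ℂ A Δ ε h = 1)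
    (hs : star h = h) (φ : A →ₗ[ℂ] ℂ) : ∃ r : ℝ, 0 ≤ r ∧
      LinearMap.mul' ℂ ℂ (TensorProduct.map (conjDual A φ ∘ₗ S) φ (Δ h)) = (r : ℂ) := by
  have hW := hA.toWeakHopfAlgebra
  have hmul := hW.antipode_mul hl hl₁
  have hS := hA.antipode_star_antipode_star hl hr hr₁ hs
  have hinj : Function.Injective S :=
    LinearMap.injective_iff_surjective.2 fun x ↦ ⟨_, hS x⟩
  have hS' (x : A) : star (S (star (S x))) = x := hinj (hS (S x))
  have key (a b c d : A) (X : A ⊗[ℂ] A) : S.rTensor A ((a ⊗ₜ[ℂ] c) * X * (b ⊗ₜ[ℂ] d)) =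
      (S b ⊗ₜ[ℂ] c) * S.rTensor A X * (S a ⊗ₜ[ℂ] d) := by
    induction X with
    | zero => simp
    | tmul p q => simp [hmul, mul_assoc]
    | add p q hp hq => simp only [map_add, mul_add, add_mul, hp, hq]
  have hone := hW.antipode_one hl hl₁
  have hT₁ (x : A) : (x ⊗ₜ[ℂ] 1) * S.rTensor A (Δ h) = S.rTensor A (Δ h) * (1 ⊗ₜ[ℂ] x) := by
    have h₁ := congrArg (S.rTensor A) (hW.comul_mul_tmul_antipode hr (star (S (star x))))
    have h₂ := key 1 (star (S (star x))) 1 1 (Δ h)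
    have h₃ := key 1 1 1 x (Δ h)
    simp only [hone, hS, ← Algebra.TensorProduct.one_def, one_mul, mul_one] at h₁ h₂ h₃
    rw [← h₂, ← h₃, h₁]
  have hT₂ (x : A) : (1 ⊗ₜ[ℂ] x) * S.rTensor A (Δ h) =
      S.rTensor A (Δ h) * (S (S x) ⊗ₜ[ℂ] 1) := by
    have h₁ := congrArg (S.rTensor A) (hW.antipode_tmul_mul_comul hl x)
    have h₂ := key 1 1 x 1 (Δ h)
    have h₃ := key (S x) 1 1 1 (Δ h)
    simp only [hone, ← Algebra.TensorProduct.one_def, one_mul, mul_one] at h₁ h₂ h₃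
    rw [← h₂, ← h₃, h₁]
  obtain ⟨n, b, hb⟩ := ht.exists_eq_sum_star_tmul hone hmul hS' hT₁ hT₂
    (by rw [hW.antipode_b, hr₁])
  refine ⟨∑ i, Complex.normSq (φ (b i)), Finset.sum_nonneg fun i _ ↦ Complex.normSq_nonneg _, ?_⟩
  have hcomp : TensorProduct.map (conjDual A φ ∘ₗ S) φ (Δ h) =
      TensorProduct.map (conjDual A φ) φ (S.rTensor A (Δ h)) := by
    rw [← LinearMap.map_comp_rTensor, LinearMap.comp_apply]
  simp [hcomp, hb, conjDual_apply, Complex.normSq_eq_conj_mul_self]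

end CStarWeakHopfAlgebra

end Haar

/-- Every (finite-dimensional) `C*`-weak Hopf algebra possesses a Haar
integral `h` (a two-sided integral with `Π^L(h) = 1 = Π^R(h)`), which is selfadjoint,
and for every linear functional `φ ∈ A*` the number
`Σ conj(φ(S(h₍₁₎)*)) ⬝ φ(h₍₂₎)` is a nonnegative real number.  (The first Sweedler leg
carries the `ℂ`-linear functional `a ↦ conj(φ(S(a)*)) = (conjDual φ)(S a)`.) -/
theorem cstarWeakHopfAlgebra_exists_haar
    (A : Type*) [NormedRing A] [StarRing A] [CStarRing A] [NormedAlgebra ℂ A]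
    [StarModule ℂ A] [FiniteDimensional ℂ A]
    (Δ : A →ₗ[ℂ] A ⊗[ℂ] A) (ε : A →ₗ[ℂ] ℂ) (S : A →ₗ[ℂ] A)
    (hA : CStarWeakHopfAlgebra A Δ ε S) :
    ∃ h : A,
      (∀ x : A, x * h = piL ℂ A Δ ε x * h) ∧
      (∀ x : A, h * x = h * piR ℂ A Δ ε x) ∧
      piL ℂ A Δ ε h = 1 ∧ piR ℂ A Δ ε h = 1 ∧
      star h = h ∧
      (∀ φ : A →ₗ[ℂ] ℂ, ∃ r : ℝ, 0 ≤ r ∧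
        LinearMap.mul' ℂ ℂ (TensorProduct.map (conjDual A φ ∘ₗ S) φ (Δ h)) = (r : ℂ)) := by
  have := FiniteDimensional.complete ℂ A
  let _ : CStarAlgebra A := {}
  obtain ⟨t, ht⟩ := exists_faithful_trace A
  obtain ⟨h, hl, hr, hl₁, hr₁, hs⟩ := hA.exists_haar_integral ht
  exact ⟨h, hl, hr, hl₁, hr₁, hs, hA.exists_nonneg_mul'_map ht hl hr hl₁ hr₁ hs⟩
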